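/- Let R be a subdirect product of smooth finite idempotent algebras A1 and A2 omitting type 1, and let C1, C2 be as-components of A1, A2, respectively. Then either R ∩ (C1×C2) is empty, or R ∩ (C1×C2) is a subdirect product of C1 and C2 (its projections to the two coordinates are all of C1 and all of C2). -/

import Mathlib

/-! Common framework: universal algebras over a fixed signature, terms,
subalgebras, congruences, quotients, edges and their types (Bulatov's
coloured-graph approach), thin edges, connectivity, products, etc. -/

/-- A (functional) signature: a type of operation symbols with arities. -/
structure Signature where
  ops : Type
  arity : ops → ℕ

/-- An algebra of a given signature. -/
structure UAlgebra (σ : Signature) where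
  carrier : Type
  interp : ∀ f : σ.ops, (Fin (σ.arity f) → carrier) → carrier

/-- Terms over the signature `σ` in `n` variables. -/
inductive Term (σ : Signature) (n : ℕ) where
  | var : Fin n → Term σ n
  | app : (f : σ.ops) → (Fin (σ.arity f) → Term σ n) → Term σ n

/-- Evaluation of a term in an algebra; term operations of an algebra are
exactly the operations of the form `Term.eval A t`. -/
def Term.eval {σ : Signature} {n : ℕ} (A : UAlgebra σ) :
    Term σ n → (Fin n → A.carrier) → A.carrier
  | .var i, x => x i
  | .app f ts, x => A.interp f fun j => Term.eval A (ts j) x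

namespace UAlgebra

variable {σ : Signature}

/-- An algebra is idempotent if all its basic operations are. -/
def Idempotent (A : UAlgebra σ) : Prop :=
  ∀ (f : σ.ops) (a : A.carrier), A.interp f (fun _ => a) = a

/-- A set closed under all basic operations. -/
def IsClosed (A : UAlgebra σ) (S : Set A.carrier) : Prop :=
  ∀ (f : σ.ops) (x : Fin (σ.arity f) → A.carrier), (∀ j, x j ∈ S) → A.interp f x ∈ S

/-- Closure of a set under the basic operations. -/
inductive Closure (A : UAlgebra σ) (S : Set A.carrier) : A.carrier → Prop
  | base {a : A.carrier} : a ∈ S → Closure A S a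
  | app (f : σ.ops) (x : Fin (σ.arity f) → A.carrier) :
      (∀ j, Closure A S (x j)) → Closure A S (A.interp f x)

def ClosureSet (A : UAlgebra σ) (S : Set A.carrier) : Set A.carrier := {x | Closure A S x}

theorem closureSet_isClosed (A : UAlgebra σ) (S : Set A.carrier) :
    A.IsClosed (A.ClosureSet S) := fun f x h => Closure.app f x h

/-- The subalgebra of `A` on a closed subset `S`. -/
def subalg (A : UAlgebra σ) (S : Set A.carrier) (hS : A.IsClosed S) : UAlgebra σ where
  carrier := {x : A.carrier // x ∈ S}
  interp f x := ⟨A.interp f fun j => (x j : A.carrier), hS f _ fun j => (x j).2⟩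

/-- The subalgebra generated by a set `S`. -/
def Sg (A : UAlgebra σ) (S : Set A.carrier) : UAlgebra σ :=
  A.subalg (A.ClosureSet S) (A.closureSet_isClosed S)

/-- `a` as an element of `Sg {a, b}`. -/
def sgA (A : UAlgebra σ) (a b : A.carrier) : (A.Sg {a, b}).carrier :=
  ⟨a, Closure.base (Set.mem_insert a {b})⟩

/-- `b` as an element of `Sg {a, b}`. -/
def sgB (A : UAlgebra σ) (a b : A.carrier) : (A.Sg {a, b}).carrier :=
  ⟨b, Closure.base (Set.mem_insert_iff.mpr (Or.inr rfl))⟩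

/-- A congruence of an algebra. -/
structure Congruence (A : UAlgebra σ) where
  rel : A.carrier → A.carrier → Prop
  refl : ∀ x, rel x x
  symm : ∀ {x y}, rel x y → rel y x
  trans : ∀ {x y z}, rel x y → rel y z → rel x z
  compat : ∀ (f : σ.ops) (x y : Fin (σ.arity f) → A.carrier),
      (∀ j, rel (x j) (y j)) → rel (A.interp f x) (A.interp f y)

def Congruence.toSetoid {A : UAlgebra σ} (θ : Congruence A) : Setoid A.carrier :=
  ⟨θ.rel, ⟨θ.refl, θ.symm, θ.trans⟩⟩

/-- The full congruence. -/
def Congruence.IsFull {A : UAlgebra σ} (θ : Congruence A) : Prop := ∀ x y, θ.rel x y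

def Congruence.le {A : UAlgebra σ} (θ η : Congruence A) : Prop :=
  ∀ x y, θ.rel x y → η.rel x y

/-- A maximal congruence: proper, and any congruence above it is full or below it. -/
def Congruence.IsMaximal {A : UAlgebra σ} (θ : Congruence A) : Prop :=
  ¬ θ.IsFull ∧ ∀ η : Congruence A, θ.le η → ¬ η.IsFull → η.le θ

/-- The quotient (factor) algebra. -/
noncomputable def quot (A : UAlgebra σ) (θ : Congruence A) : UAlgebra σ where
  carrier := Quotient θ.toSetoid
  interp f x := Quotient.mk θ.toSetoid (A.interp f fun j => (x j).out)

/-- The class of `a` in the quotient of `Sg {a,b}` by `θ`. -/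
def qa (A : UAlgebra σ) (a b : A.carrier) (θ : Congruence (A.Sg {a, b})) :
    ((A.Sg {a, b}).quot θ).carrier :=
  Quotient.mk θ.toSetoid (A.sgA a b)

def qb (A : UAlgebra σ) (a b : A.carrier) (θ : Congruence (A.Sg {a, b})) :
    ((A.Sg {a, b}).quot θ).carrier :=
  Quotient.mk θ.toSetoid (A.sgB a b)

end UAlgebra

/-- A binary operation is a semilattice operation on a set `B`. -/
def IsSemilatticeOn {α : Type} (f : α → α → α) (B : Set α) : Prop :=
  (∀ x ∈ B, f x x = x) ∧ (∀ x ∈ B, ∀ y ∈ B, f x y = f y x) ∧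
    (∀ x ∈ B, ∀ y ∈ B, ∀ z ∈ B, f x (f y z) = f (f x y) z)

/-- A ternary operation is a majority operation on a set `B`. -/
def IsMajorityOn {α : Type} (g : α → α → α → α) (B : Set α) : Prop :=
  ∀ x ∈ B, ∀ y ∈ B, g x x y = x ∧ g x y x = x ∧ g y x x = x

/-- A ternary operation is a Mal'tsev operation on a set `B`. -/
def IsMaltsevOn {α : Type} (h : α → α → α → α) (B : Set α) : Prop :=
  ∀ x ∈ B, ∀ y ∈ B, h x y y = x ∧ h y y x = x

namespace UAlgebra

variable {σ : Signature}

/-- An algebra is "a set": every term operation is a projection. -/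
def IsSetAlgebra (Q : UAlgebra σ) : Prop :=
  ∀ (n : ℕ) (t : Term σ n), ∃ i : Fin n, ∀ x : Fin n → Q.carrier, t.eval Q x = x i

/-- An algebra is the full idempotent reduct of a module over some finite ring:
its term operations are exactly the idempotent affine combinations; in
particular the affine operation `x - y + z` is a term operation. -/
def IsAffineAlgebra (Q : UAlgebra σ) : Prop :=
  ∃ (R : Type) (_ : Ring R) (_ : Finite R) (_ : AddCommGroup Q.carrier)
    (_ : Module R Q.carrier),
    (∀ (n : ℕ) (g : (Fin n → Q.carrier) → Q.carrier),
      (∃ t : Term σ n, ∀ x, t.eval Q x = g x) ↔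
      (∃ c : Fin n → R, (∑ i, c i) = 1 ∧ ∀ x, g x = ∑ i, c i • x i)) ∧
    (∃ t : Term σ 3, ∀ x y z : Q.carrier, t.eval Q ![x, y, z] = x - y + z)

/-- `θ` witnesses that `ab` is an edge of the unary type. -/
def UnaryWitness (A : UAlgebra σ) (a b : A.carrier) (θ : Congruence (A.Sg {a, b})) : Prop :=
  θ.IsMaximal ∧ IsSetAlgebra ((A.Sg {a, b}).quot θ)

/-- `θ` witnesses that `ab` is an edge of the semilattice type. -/
def SLWitness (A : UAlgebra σ) (a b : A.carrier) (θ : Congruence (A.Sg {a, b})) : Prop :=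
  θ.IsMaximal ∧ ∃ t : Term σ 2,
    IsSemilatticeOn (fun x y => t.eval ((A.Sg {a, b}).quot θ) ![x, y])
      {A.qa a b θ, A.qb a b θ}

/-- `θ` witnesses that `ab` is an edge of the majority type. -/
def MajWitness (A : UAlgebra σ) (a b : A.carrier) (θ : Congruence (A.Sg {a, b})) : Prop :=
  θ.IsMaximal ∧
  (∃ t : Term σ 3,
    IsMajorityOn (fun x y z => t.eval ((A.Sg {a, b}).quot θ) ![x, y, z])
      {A.qa a b θ, A.qb a b θ}) ∧
  ¬ (∃ t : Term σ 2,
    IsSemilatticeOn (fun x y => t.eval ((A.Sg {a, b}).quot θ) ![x, y])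
      {A.qa a b θ, A.qb a b θ})

/-- `θ` witnesses that `ab` is an edge of the affine type. -/
def AffWitness (A : UAlgebra σ) (a b : A.carrier) (θ : Congruence (A.Sg {a, b})) : Prop :=
  θ.IsMaximal ∧ IsAffineAlgebra ((A.Sg {a, b}).quot θ)

/-- A pair of distinct elements is an edge. -/
def IsEdge (A : UAlgebra σ) (a b : A.carrier) : Prop :=
  a ≠ b ∧ ∃ θ : Congruence (A.Sg {a, b}), ¬ θ.IsFull ∧
    (IsSetAlgebra ((A.Sg {a, b}).quot θ) ∨
     IsAffineAlgebra ((A.Sg {a, b}).quot θ) ∨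
     (∃ t : Term σ 2,
        IsSemilatticeOn (fun x y => t.eval ((A.Sg {a, b}).quot θ) ![x, y])
          {A.qa a b θ, A.qb a b θ}) ∨
     (∃ t : Term σ 3,
        IsMajorityOn (fun x y z => t.eval ((A.Sg {a, b}).quot θ) ![x, y, z])
          {A.qa a b θ, A.qb a b θ}))

def IsUnaryEdge (A : UAlgebra σ) (a b : A.carrier) : Prop :=
  a ≠ b ∧ ∃ θ : Congruence (A.Sg {a, b}), UnaryWitness A a b θ

def IsSLEdge (A : UAlgebra σ) (a b : A.carrier) : Prop :=
  a ≠ b ∧ ∃ θ : Congruence (A.Sg {a, b}), SLWitness A a b θ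

def IsMajEdge (A : UAlgebra σ) (a b : A.carrier) : Prop :=
  a ≠ b ∧ ∃ θ : Congruence (A.Sg {a, b}), MajWitness A a b θ

def IsAffEdge (A : UAlgebra σ) (a b : A.carrier) : Prop :=
  a ≠ b ∧ ∃ θ : Congruence (A.Sg {a, b}), AffWitness A a b θ

end UAlgebra

/-- The four types of edges. -/
inductive EdgeType where
  | unary | semilattice | majority | affine
deriving DecidableEq

namespace UAlgebra

variable {σ : Signature}

def HasEdgeOfType (A : UAlgebra σ) (τ : EdgeType) (a b : A.carrier) : Prop :=
  match τ with
  | .unary => A.IsUnaryEdge a b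
  | .semilattice => A.IsSLEdge a b
  | .majority => A.IsMajEdge a b
  | .affine => A.IsAffEdge a b

/-- `T`-restricted algebra: every edge has a type from `T`. -/
def Restricted (A : UAlgebra σ) (T : Set EdgeType) : Prop :=
  ∀ a b : A.carrier, A.IsEdge a b → ∃ τ ∈ T, A.HasEdgeOfType τ a b

/-- `A` omits type 1: no subalgebra of `A` has an edge of the unary type. -/
def OmitsType1 (A : UAlgebra σ) : Prop :=
  ∀ (S : Set A.carrier) (hS : A.IsClosed S) (a b : (A.subalg S hS).carrier),
    ¬ (A.subalg S hS).IsUnaryEdge a b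

/-- The union of the two `θ`-blocks of a thick edge, as a subset of `A`. -/
def edgeBlockUnion (A : UAlgebra σ) (a b : A.carrier) (θ : Congruence (A.Sg {a, b})) :
    Set A.carrier :=
  {x | ∃ hx : x ∈ A.ClosureSet {a, b},
    θ.rel ⟨x, hx⟩ (A.sgA a b) ∨ θ.rel ⟨x, hx⟩ (A.sgB a b)}

/-- Smooth algebra: for every semilattice- or majority-type edge with a witnessing
maximal congruence, the union of the two blocks is a subuniverse. -/
def IsSmooth (A : UAlgebra σ) : Prop :=
  ∀ (a b : A.carrier) (θ : Congruence (A.Sg {a, b})),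
    (SLWitness A a b θ ∨ MajWitness A a b θ) → A.IsClosed (A.edgeBlockUnion a b θ)

def SemilatticeFree (A : UAlgebra σ) : Prop := ∀ a b : A.carrier, ¬ A.IsSLEdge a b
def MajorityFree (A : UAlgebra σ) : Prop := ∀ a b : A.carrier, ¬ A.IsMajEdge a b
def AffineFree (A : UAlgebra σ) : Prop := ∀ a b : A.carrier, ¬ A.IsAffEdge a b

/-- Thin semilattice edge. -/
def IsThinSLEdge (A : UAlgebra σ) (a b : A.carrier) : Prop :=
  ∃ t : Term σ 2, t.eval A ![a, a] = a ∧ t.eval A ![a, b] = b ∧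
    t.eval A ![b, a] = b ∧ t.eval A ![b, b] = b

/-- Undirected thin majority edge: some term operation is majority on `{a, b}`. -/
def IsUndirThinMajEdge (A : UAlgebra σ) (a b : A.carrier) : Prop :=
  ∃ t : Term σ 3, IsMajorityOn (fun x y z => t.eval A ![x, y, z]) {a, b}

/-- Mal'tsev edge: some term operation is Mal'tsev on `{a, b}`. -/
def IsMaltsevEdge (A : UAlgebra σ) (a b : A.carrier) : Prop :=
  ∃ t : Term σ 3, IsMaltsevOn (fun x y z => t.eval A ![x, y, z]) {a, b}

/-- The class of all quotients of subalgebras of `A`. -/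
def QuotSub (A : UAlgebra σ) : Set (UAlgebra σ) :=
  {B | ∃ (S : Set A.carrier) (hS : A.IsClosed S)
        (θ : Congruence (A.subalg S hS)), B = (A.subalg S hS).quot θ}

end UAlgebra

/-- The class of all quotients of subalgebras of the algebras of a class. -/
def QuotSubClass {σ : Signature} (K : Set (UAlgebra σ)) : Set (UAlgebra σ) :=
  {B | ∃ A ∈ K, B ∈ UAlgebra.QuotSub A}

/-- A ternary term satisfies the majority condition relative to a class `𝒦`. -/
def MajorityCondition {σ : Signature} (𝒦 : Set (UAlgebra σ)) (t : Term σ 3) : Prop :=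
  (∀ B ∈ 𝒦, ∀ x y : B.carrier,
    t.eval B ![x, t.eval B ![x, y, y], t.eval B ![x, y, y]] = t.eval B ![x, y, y]) ∧
  (∀ B ∈ 𝒦, ∀ (a b : B.carrier) (θ : UAlgebra.Congruence (B.Sg {a, b})),
    a ≠ b → UAlgebra.MajWitness B a b θ →
    IsMajorityOn (fun x y z => t.eval ((B.Sg {a, b}).quot θ) ![x, y, z])
      {B.qa a b θ, B.qb a b θ})

/-- A ternary term satisfies the minority condition relative to a class `𝒦`. -/
def MinorityCondition {σ : Signature} (𝒦 : Set (UAlgebra σ)) (t : Term σ 3) : Prop :=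
  (∀ B ∈ 𝒦, ∀ x y : B.carrier,
    t.eval B ![t.eval B ![x, y, y], y, y] = t.eval B ![x, y, y]) ∧
  (∀ B ∈ 𝒦, ∀ (a b : B.carrier) (θ : UAlgebra.Congruence (B.Sg {a, b})),
    a ≠ b → UAlgebra.AffWitness B a b θ →
    IsMaltsevOn (fun x y z => t.eval ((B.Sg {a, b}).quot θ) ![x, y, z])
      {B.qa a b θ, B.qb a b θ})

/-- Thin majority edge relative to a class `𝒦`. -/
def IsThinMajEdge {σ : Signature} (𝒦 : Set (UAlgebra σ)) (A : UAlgebra σ)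
    (a b : A.carrier) : Prop :=
  ∀ t : Term σ 3, MajorityCondition 𝒦 t →
    b ∈ A.ClosureSet {a, t.eval A ![a, b, b]} ∧
    b ∈ A.ClosureSet {a, t.eval A ![b, a, b]} ∧
    b ∈ A.ClosureSet {a, t.eval A ![b, b, a]}

/-- Thin affine edge relative to a class `𝒦` (with respect to some fixed term
operation satisfying the minority condition). -/
def IsThinAffEdge {σ : Signature} (𝒦 : Set (UAlgebra σ)) (A : UAlgebra σ)
    (a b : A.carrier) : Prop :=
  (∃ t : Term σ 3, MinorityCondition 𝒦 t ∧ t.eval A ![b, a, a] = b) ∧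
  ∀ t : Term σ 3, MinorityCondition 𝒦 t → b ∈ A.ClosureSet {a, t.eval A ![a, a, b]}

namespace UAlgebra

variable {σ : Signature}

/-- Reachability in the digraph `Gs(A)` of thin semilattice edges. -/
def sReach (A : UAlgebra σ) : A.carrier → A.carrier → Prop :=
  Relation.ReflTransGen (fun x y => A.IsThinSLEdge x y)

/-- A maximal element of `Gs(A)`: an element of a maximal strongly connected
component. -/
def IsMaxElem (A : UAlgebra σ) (a : A.carrier) : Prop :=
  ∀ b, A.sReach a b → A.sReach b a

/-- A maximal component of `Gs(A)`: the strongly connected component of a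
maximal element. -/
def IsMaxComponent (A : UAlgebra σ) (C : Set A.carrier) : Prop :=
  ∃ a, A.IsMaxElem a ∧ C = {b | A.sReach a b ∧ A.sReach b a}

end UAlgebra

/-- An arc of the digraph `Gas(A)`: a thin semilattice or thin affine edge. -/
def asStep {σ : Signature} (𝒦 : Set (UAlgebra σ)) (A : UAlgebra σ)
    (x y : A.carrier) : Prop :=
  A.IsThinSLEdge x y ∨ IsThinAffEdge 𝒦 A x y

/-- Reachability in `Gas(A)`. -/
def asReach {σ : Signature} (𝒦 : Set (UAlgebra σ)) (A : UAlgebra σ) :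
    A.carrier → A.carrier → Prop :=
  Relation.ReflTransGen (asStep 𝒦 A)

/-- An as-maximal element: an element of an as-component. -/
def IsAsMaxElem {σ : Signature} (𝒦 : Set (UAlgebra σ)) (A : UAlgebra σ)
    (a : A.carrier) : Prop :=
  ∀ b, asReach 𝒦 A a b → asReach 𝒦 A b a

/-- An as-component of `A`: a maximal strongly connected component of `Gas(A)`. -/
def IsAsComponent {σ : Signature} (𝒦 : Set (UAlgebra σ)) (A : UAlgebra σ)
    (C : Set A.carrier) : Prop :=
  ∃ a, IsAsMaxElem 𝒦 A a ∧ C = {b | asReach 𝒦 A a b ∧ asReach 𝒦 A b a}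

namespace UAlgebra

variable {σ : Signature}

/-- Binary direct product. -/
def prod (A B : UAlgebra σ) : UAlgebra σ where
  carrier := A.carrier × B.carrier
  interp f x := (A.interp f fun j => (x j).1, B.interp f fun j => (x j).2)

/-- Direct product of a family. -/
def pi {ι : Type} (A : ι → UAlgebra σ) : UAlgebra σ where
  carrier := ∀ i, (A i).carrier
  interp f x := fun i => (A i).interp f fun j => x j i

/-- Homomorphism of similar algebras. -/
def IsHom (A B : UAlgebra σ) (φ : A.carrier → B.carrier) : Prop :=
  ∀ (f : σ.ops) (x : Fin (σ.arity f) → A.carrier),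
    φ (A.interp f x) = B.interp f fun j => φ (x j)

/-- Simple algebra: only the equality and full congruences. -/
def IsSimple (A : UAlgebra σ) : Prop :=
  ∀ θ : Congruence A, (∀ x y, θ.rel x y ↔ x = y) ∨ θ.IsFull

/-- Maximal generated algebra: generated by one of its maximal components. -/
def MaximalGenerated (A : UAlgebra σ) : Prop :=
  ∃ C : Set A.carrier, A.IsMaxComponent C ∧ A.ClosureSet C = Set.univ

/-- The number of subalgebras (nonempty closed subsets) of an algebra. -/
noncomputable def numSubalgebras (A : UAlgebra σ) : ℕ :=
  Nat.card {S : Set A.carrier // S.Nonempty ∧ A.IsClosed S}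

end UAlgebra

/-- A (k+3)-ary term is an edge term for a class `𝒦`. -/
def IsEdgeTermFor {σ : Signature} (𝒦 : Set (UAlgebra σ)) {k : ℕ}
    (t : Term σ (k + 3)) : Prop :=
  ∀ A ∈ 𝒦, ∀ x y : A.carrier,
    t.eval A (fun i => if i.val ≤ 1 then y else x) = x ∧
    t.eval A (fun i => if i.val = 0 ∨ i.val = 2 then y else x) = x ∧
    ∀ j : Fin (k + 3), 3 ≤ j.val →
      t.eval A (Function.update (fun _ => x) j y) = x

/-- A finite class has few subproducts. -/
def FewSubproducts {σ : Signature} (K : Set (UAlgebra σ)) : Prop :=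
  ∃ p : Polynomial ℕ, ∀ (n : ℕ) (A : Fin n → UAlgebra σ), (∀ i, A i ∈ K) →
    UAlgebra.numSubalgebras (UAlgebra.pi A) ≤ 2 ^ (p.eval n)

/-- `g_K` is bounded by a polynomial: every subalgebra of an `n`-fold product
of members of `K` has a generating set of polynomial size. -/
def PolyGenerated {σ : Signature} (K : Set (UAlgebra σ)) : Prop :=
  ∃ p : Polynomial ℕ, ∀ (n : ℕ) (A : Fin n → UAlgebra σ), (∀ i, A i ∈ K) →
    ∀ S : Set (UAlgebra.pi A).carrier, S.Nonempty → (UAlgebra.pi A).IsClosed S →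
      ∃ G : Set (UAlgebra.pi A).carrier, G ⊆ S ∧ G.Finite ∧
        G.ncard ≤ p.eval n ∧ (UAlgebra.pi A).ClosureSet G = S

/-- Every element of a finite monoid has an idempotent positive power. -/
theorem exists_isIdempotentElem_pow {M : Type*} [Monoid M] [Finite M] (g : M) :
    ∃ k, k ≠ 0 ∧ IsIdempotentElem (g ^ k) := by
  obtain ⟨m, n, hmn, h⟩ : ∃ m n : ℕ, m < n ∧ g ^ m = g ^ n := by
    obtain ⟨m, n, hne, h⟩ := Finite.exists_ne_map_eq_of_infinite fun k : ℕ => g ^ k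
    rcases hne.lt_or_gt with hlt | hlt
    exacts [⟨m, n, hlt, h⟩, ⟨n, m, hlt, h.symm⟩]
  obtain ⟨p, rfl⟩ := Nat.exists_eq_add_of_lt hmn
  have hperiod : ∀ i, g ^ (m + (p + 1) * i) = g ^ m := by
    intro i
    induction i with
    | zero => simp
    | succ i ih => rw [mul_add, mul_one, ← add_assoc, pow_add, ih, ← pow_add, h, add_assoc]
  have hk : (p + 1) * (m + 1) = m + (p * (m + 1) + 1) := by ring
  refine ⟨(p + 1) * (m + 1), by positivity, ?_⟩
  calc g ^ ((p + 1) * (m + 1)) * g ^ ((p + 1) * (m + 1))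
      = g ^ (m + (p + 1) * (m + 1)) * g ^ (p * (m + 1) + 1) := by
        rw [← pow_add, ← pow_add]
        congr 1
        ring
    _ = g ^ ((p + 1) * (m + 1)) := by rw [hperiod, ← pow_add, hk]

namespace Term

variable {σ : Signature}

/-- Simultaneous substitution of terms for variables. -/
def subst {n m : ℕ} : Term σ n → (Fin n → Term σ m) → Term σ m
  | .var i, s => s i
  | .app f ts, s => .app f fun j => (ts j).subst s

theorem eval_subst {n m : ℕ} (A : UAlgebra σ) (t : Term σ n) (s : Fin n → Term σ m)
    (x : Fin m → A.carrier) :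
    (t.subst s).eval A x = t.eval A fun i => (s i).eval A x := by
  induction t with
  | var i => rfl
  | app f ts ih => simp only [subst, eval, ih]

/-- Composition of binary terms: `t (r x y) (s x y)`. -/
def comp₂ (t r s : Term σ 2) : Term σ 2 := t.subst ![r, s]

theorem eval_comp₂ (A : UAlgebra σ) (t r s : Term σ 2) (x : Fin 2 → A.carrier) :
    (t.comp₂ r s).eval A x = t.eval A ![r.eval A x, s.eval A x] := by
  rw [comp₂, eval_subst]
  congr 1
  funext i
  fin_cases i <;> rfl

theorem eval_of_idempotent {A : UAlgebra σ} (hA : A.Idempotent) {n : ℕ} (t : Term σ n)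
    (a : A.carrier) : t.eval A (fun _ => a) = a := by
  induction t with
  | var i => rfl
  | app f ts ih => simp only [eval, ih, hA f a]

theorem eval_diag {A : UAlgebra σ} (hA : A.Idempotent) (t : Term σ 2) (a : A.carrier) :
    t.eval A ![a, a] = a := by
  have h : (![a, a] : Fin 2 → A.carrier) = fun _ => a := by
    funext i
    fin_cases i <;> rfl
  rw [h, eval_of_idempotent hA]

/-- Term operations preserve closed sets. -/
theorem eval_mem {A : UAlgebra σ} {S : Set A.carrier} (hS : A.IsClosed S) {n : ℕ}
    (t : Term σ n) {x : Fin n → A.carrier} (hx : ∀ i, x i ∈ S) : t.eval A x ∈ S := by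
  induction t with
  | var i => exact hx i
  | app f ts ih => exact hS f _ ih

/-- Coordinatewise evaluation preserves subalgebras of a binary product. -/
theorem eval_prod_mem {A B : UAlgebra σ} {R : Set (A.prod B).carrier}
    (hR : (A.prod B).IsClosed R) {n : ℕ} (t : Term σ n) {x : Fin n → A.carrier}
    {y : Fin n → B.carrier} (h : ∀ i, (x i, y i) ∈ R) : (t.eval A x, t.eval B y) ∈ R := by
  induction t with
  | var i => exact h i
  | app f ts ih => exact hR f (fun j => ((ts j).eval A x, (ts j).eval B y)) ih

theorem eval_quot (A : UAlgebra σ) (θ : UAlgebra.Congruence A) {n : ℕ} (t : Term σ n)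
    (x : Fin n → A.carrier) :
    t.eval (A.quot θ) (fun i => Quotient.mk θ.toSetoid (x i)) =
      Quotient.mk θ.toSetoid (t.eval A x) := by
  induction t with
  | var i => rfl
  | app f ts ih =>
    simp only [eval, ih]
    exact Quotient.sound (θ.compat f _ _ fun j =>
      Quotient.mk_out (s := θ.toSetoid) ((ts j).eval A x))

theorem eval_subalg (A : UAlgebra σ) {S : Set A.carrier} (hS : A.IsClosed S) {n : ℕ}
    (t : Term σ n) (x : Fin n → (A.subalg S hS).carrier) :
    (t.eval (A.subalg S hS) x).1 = t.eval A fun i => (x i).1 := by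
  induction t with
  | var i => rfl
  | app f ts ih =>
    simp only [eval, ← ih]
    rfl

/-- The term `x ⬝ (x ⬝ ⋯ (x ⬝ y))` with `k` occurrences of `x`. -/
def iterRight (t : Term σ 2) : ℕ → Term σ 2
  | 0 => .var 1
  | k + 1 => t.comp₂ (.var 0) (t.iterRight k)

theorem eval_iterRight (A : UAlgebra σ) (t : Term σ 2) (k : ℕ) (x y : A.carrier) :
    (t.iterRight k).eval A ![x, y] = (fun z => t.eval A ![x, z])^[k] y := by
  induction k with
  | zero => rfl
  | succ k ih =>
    rw [iterRight, eval_comp₂, ih, Function.iterate_succ_apply']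
    rfl

/-- In a finite algebra some positive iterate of `t` in its second variable is idempotent as a
unary operation. -/
theorem exists_iterRight_absorb (B : UAlgebra σ) [Finite B.carrier] (t : Term σ 2) :
    ∃ k, k ≠ 0 ∧ ∀ x y : B.carrier,
      (t.iterRight k).eval B ![x, (t.iterRight k).eval B ![x, y]] =
        (t.iterRight k).eval B ![x, y] := by
  let g : B.carrier → Function.End B.carrier := fun x z => t.eval B ![x, z]
  have : Finite (B.carrier → Function.End B.carrier) :=
    inferInstanceAs (Finite (B.carrier → B.carrier → B.carrier))
  obtain ⟨k, hk, hidem⟩ := exists_isIdempotentElem_pow g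
  have hpow : ∀ (x y : B.carrier), (g ^ k) x y = (t.iterRight k).eval B ![x, y] := by
    intro x y
    rw [eval_iterRight, Pi.pow_apply]
    rfl
  refine ⟨k, hk, fun x y => ?_⟩
  rw [← hpow x y, ← hpow]
  exact congrFun (congrFun hidem.eq x) y

/-- The value `b` is stable under iteration along a thin semilattice pair. -/
theorem eval_iterRight_of_eq {A : UAlgebra σ} {t : Term σ 2} {x y b : A.carrier}
    (hy : t.eval A ![x, y] = b) (hb : t.eval A ![x, b] = b) {k : ℕ} (hk : k ≠ 0) :
    (t.iterRight k).eval A ![x, y] = b := by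
  obtain ⟨k, rfl⟩ := Nat.exists_eq_succ_of_ne_zero hk
  rw [eval_iterRight, Function.iterate_succ_apply]
  exact (congrArg _ hy).trans (Function.iterate_fixed hb k)

/-- A thin semilattice edge of `A` yields a partial semilattice term on a finite idempotent algebra `B`
that still maps the edge to its endpoint. -/
theorem exists_partialSemilattice {A B : UAlgebra σ} [Finite B.carrier] (hB : B.Idempotent)
    {a a' : A.carrier} (h : A.IsThinSLEdge a a') :
    ∃ s : Term σ 2, s.eval A ![a, a'] = a' ∧
      ∀ x y : B.carrier, B.IsThinSLEdge x (s.eval B ![x, y]) := by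
  obtain ⟨f, -, hab, hba, hbb⟩ := h
  obtain ⟨k, hk, hkB⟩ := exists_iterRight_absorb B f
  set t := f.iterRight k
  have htab : t.eval A ![a, a'] = a' := eval_iterRight_of_eq hab hab hk
  have htba : t.eval A ![a', a] = a' := eval_iterRight_of_eq hba hbb hk
  let u : Term σ 2 := t.comp₂ (.var 0) (t.comp₂ (.var 1) (.var 0))
  have hu : ∀ (D : UAlgebra σ) (x y : D.carrier),
      u.eval D ![x, y] = t.eval D ![x, t.eval D ![y, x]] := by
    intro D x y
    simp only [u, eval_comp₂]
    rfl
  obtain ⟨l, hl, hlB⟩ := exists_iterRight_absorb B u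
  have huab : u.eval A ![a, a'] = a' := by rw [hu, htba, htab]
  refine ⟨u.iterRight l, eval_iterRight_of_eq huab huab hl, fun x y => ?_⟩
  set z := (u.iterRight l).eval B ![x, y] with hz
  have hsz : (u.iterRight l).eval B ![x, z] = z := hlB x y
  obtain ⟨w, hw⟩ : ∃ w, u.eval B ![x, w] = z := by
    obtain ⟨l, rfl⟩ := Nat.exists_eq_succ_of_ne_zero hl
    rw [eval_iterRight, Function.iterate_succ_apply'] at hz
    exact ⟨_, hz.symm⟩
  have htz : t.eval B ![x, z] = z := by
    rw [← hw, hu, hkB]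
  have huz : u.eval B ![z, x] = z := by rw [hu, htz, eval_diag hB]
  exact ⟨u.iterRight l, eval_diag hB _ _, hsz,
    eval_iterRight_of_eq huz (eval_diag hB _ _) hl, eval_diag hB _ _⟩

end Term

namespace UAlgebra

variable {σ : Signature}

theorem closureSet_subset {A : UAlgebra σ} {S T : Set A.carrier} (hT : A.IsClosed T)
    (h : S ⊆ T) : A.ClosureSet S ⊆ T := by
  intro x hx
  induction hx with
  | base ha => exact h ha
  | app f x _ ih => exact hT f x ih

theorem subset_closureSet (A : UAlgebra σ) (S : Set A.carrier) : S ⊆ A.ClosureSet S :=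
  fun _ h => Closure.base h

theorem closureSet_pair_subset {A : UAlgebra σ} {S : Set A.carrier} {a b : A.carrier}
    (ha : a ∈ A.ClosureSet S) (hb : b ∈ A.ClosureSet S) :
    A.ClosureSet {a, b} ⊆ A.ClosureSet S :=
  closureSet_subset (A.closureSet_isClosed S) (Set.pair_subset ha hb)

theorem left_mem_closureSet (A : UAlgebra σ) (a b : A.carrier) : a ∈ A.ClosureSet {a, b} :=
  A.subset_closureSet _ (Or.inl rfl)

theorem right_mem_closureSet (A : UAlgebra σ) (a b : A.carrier) : b ∈ A.ClosureSet {a, b} :=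
  A.subset_closureSet _ (Or.inr rfl)

/-- Elements of a two-generated subalgebra are values of binary terms. -/
theorem exists_term_of_mem_closureSet_pair {A : UAlgebra σ} {a b c : A.carrier}
    (h : c ∈ A.ClosureSet {a, b}) : ∃ t : Term σ 2, t.eval A ![a, b] = c := by
  induction h with
  | base hc =>
    rcases hc with rfl | rfl
    exacts [⟨.var 0, rfl⟩, ⟨.var 1, rfl⟩]
  | app f x _ ih =>
    choose t ht using ih
    exact ⟨.app f t, by simp only [Term.eval, ht]⟩

/-- Identities of the minority condition hold in the algebras of the class themselves. -/
theorem minorityCondition_eval {K : Set (UAlgebra σ)} {t : Term σ 3}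
    (ht : MinorityCondition (QuotSubClass K) t) {B : UAlgebra σ} (hB : B ∈ K)
    (x y : B.carrier) :
    t.eval B ![t.eval B ![x, y, y], y, y] = t.eval B ![x, y, y] := by
  have hS : B.IsClosed Set.univ := fun _ _ _ => trivial
  let θ : Congruence (B.subalg Set.univ hS) :=
    { rel := Eq
      refl := fun _ => rfl
      symm := Eq.symm
      trans := Eq.trans
      compat := fun f x y h => congrArg _ (funext h) }
  let φ : B.carrier → ((B.subalg Set.univ hS).quot θ).carrier :=
    fun z => Quotient.mk θ.toSetoid ⟨z, trivial⟩
  have hφ : Function.Injective φ := fun z w h => congrArg Subtype.val (Quotient.exact h)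
  have heval : ∀ p q r : B.carrier,
      t.eval ((B.subalg Set.univ hS).quot θ) ![φ p, φ q, φ r] = φ (t.eval B ![p, q, r]) := by
    intro p q r
    let v : Fin 3 → (B.subalg Set.univ hS).carrier := fun i => ⟨![p, q, r] i, trivial⟩
    have hv : (![φ p, φ q, φ r] : Fin 3 → _) = fun i => Quotient.mk θ.toSetoid (v i) := by
      funext i
      fin_cases i <;> rfl
    rw [hv, Term.eval_quot]
    exact congrArg _ (Subtype.ext (Term.eval_subalg B hS t v))
  have h := ht.1 _ ⟨B, hB, Set.univ, hS, θ, rfl⟩ (φ x) (φ y)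
  rw [heval, heval] at h
  exact hφ h

/-- A thin affine edge lifts to a subalgebra of a product. -/
theorem exists_thinAffEdge_lift {K : Set (UAlgebra σ)} {A B : UAlgebra σ} [Finite B.carrier]
    (hB : B ∈ K) {R : Set (A.prod B).carrier} (hR : (A.prod B).IsClosed R)
    {a a' : A.carrier} {b c : B.carrier} (hab : (a, b) ∈ R) (hac : (a', c) ∈ R)
    (h : IsThinAffEdge (QuotSubClass K) A a a') :
    ∃ b', (a', b') ∈ R ∧ IsThinAffEdge (QuotSubClass K) B b b' := by
  obtain ⟨⟨t, ht, hta⟩, hgen⟩ := h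
  have key : ∀ e, (a', e) ∈ R →
      (a', t.eval B ![e, b, b]) ∈ R ∧
        t.eval B ![t.eval B ![e, b, b], b, b] = t.eval B ![e, b, b] ∧
        t.eval B ![e, b, b] ∈ B.ClosureSet {b, e} := by
    intro e he
    refine ⟨?_, minorityCondition_eval ht hB e b, ?_⟩
    · have := Term.eval_prod_mem hR t (x := ![a', a, a]) (y := ![e, b, b])
        (by intro i; fin_cases i; exacts [he, hab, hab])
      rwa [hta] at this
    · refine Term.eval_mem (B.closureSet_isClosed _) t ?_
      intro i
      fin_cases i
      exacts [B.right_mem_closureSet b e, B.left_mem_closureSet b e, B.left_mem_closureSet b e]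
  obtain ⟨d, ⟨hd, htd⟩, hmin⟩ :=
    Set.Finite.exists_minimalFor (fun d => B.ClosureSet {b, d})
      {d | (a', d) ∈ R ∧ t.eval B ![d, b, b] = d} (Set.toFinite _)
      ⟨_, (key c hac).1, (key c hac).2.1⟩
  refine ⟨d, hd, ⟨t, ht, htd⟩, fun h' hh' => ?_⟩
  obtain ⟨r, hr⟩ := exists_term_of_mem_closureSet_pair (hgen h' hh')
  set q := h'.eval B ![b, b, d]
  have hqd : q ∈ B.ClosureSet {b, d} := by
    refine Term.eval_mem (B.closureSet_isClosed _) h' ?_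
    intro i
    fin_cases i
    exacts [B.left_mem_closureSet b d, B.left_mem_closureSet b d, B.right_mem_closureSet b d]
  have hqR : (h'.eval A ![a, a, a'], q) ∈ R :=
    Term.eval_prod_mem hR h' (by intro i; fin_cases i; exacts [hab, hab, hd])
  have heR : (a', r.eval B ![b, q]) ∈ R := by
    have := Term.eval_prod_mem hR r (x := ![a, h'.eval A ![a, a, a']]) (y := ![b, q])
      (by intro i; fin_cases i; exacts [hab, hqR])
    rwa [hr] at this
  have heq : r.eval B ![b, q] ∈ B.ClosureSet {b, q} := by
    refine Term.eval_mem (B.closureSet_isClosed _) r ?_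
    intro i
    fin_cases i
    exacts [B.left_mem_closureSet b q, B.right_mem_closureSet b q]
  obtain ⟨hR', hfix, hmem⟩ := key _ heR
  have hsub : B.ClosureSet {b, t.eval B ![r.eval B ![b, q], b, b]} ⊆ B.ClosureSet {b, q} :=
    closureSet_pair_subset (B.left_mem_closureSet b q)
      (closureSet_pair_subset (B.left_mem_closureSet b q) heq hmem)
  have hqsub : B.ClosureSet {b, q} ⊆ B.ClosureSet {b, d} :=
    closureSet_pair_subset (B.left_mem_closureSet b d) hqd
  exact hsub (hmin ⟨hR', hfix⟩ (hsub.trans hqsub) (B.right_mem_closureSet b d))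

/-- Paths of thin semilattice and thin affine edges lift to a subalgebra of a product whose
first projection is onto. -/
theorem exists_asReach_lift {K : Set (UAlgebra σ)} {A B : UAlgebra σ} [Finite B.carrier]
    (hB : B ∈ K) (hid : B.Idempotent) {R : Set (A.prod B).carrier}
    (hR : (A.prod B).IsClosed R) (hproj : ∀ a : A.carrier, ∃ p ∈ R, p.1 = a)
    {a a' : A.carrier} {b : B.carrier} (hab : (a, b) ∈ R)
    (h : asReach (QuotSubClass K) A a a') :
    ∃ b', (a', b') ∈ R ∧ asReach (QuotSubClass K) B b b' := by
  induction h with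
  | refl => exact ⟨b, hab, .refl⟩
  | @tail x y _ hstep ih =>
    obtain ⟨d, hd, hbd⟩ := ih
    obtain ⟨⟨y, c⟩, hc, rfl⟩ := hproj y
    rcases hstep with hstep | hstep
    · obtain ⟨s, hs, hsB⟩ := Term.exists_partialSemilattice hid hstep
      refine ⟨s.eval B ![d, c], ?_, hbd.tail (Or.inl (hsB d c))⟩
      have := Term.eval_prod_mem hR s (x := ![x, y]) (y := ![d, c])
        (by intro i; fin_cases i; exacts [hd, hc])
      rwa [hs] at this
    · obtain ⟨b', hb', hdb'⟩ := exists_thinAffEdge_lift hB hR hd hc hstep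
      exact ⟨b', hb', hbd.tail (Or.inr hdb')⟩

/-- If a subalgebra of a product projects onto the first factor and meets a product of
as-components, then it projects onto the first of these components. -/
theorem exists_mem_asComponent {K : Set (UAlgebra σ)} {A B : UAlgebra σ} [Finite B.carrier]
    (hB : B ∈ K) (hid : B.Idempotent) {R : Set (A.prod B).carrier}
    (hR : (A.prod B).IsClosed R) (hproj : ∀ a : A.carrier, ∃ p ∈ R, p.1 = a)
    {C : Set A.carrier} (hC : IsAsComponent (QuotSubClass K) A C)
    {D : Set B.carrier} (hD : IsAsComponent (QuotSubClass K) B D)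
    {a : A.carrier} {b : B.carrier} (hab : (a, b) ∈ R) (ha : a ∈ C) (hb : b ∈ D) :
    ∀ a' ∈ C, ∃ b' ∈ D, (a', b') ∈ R := by
  obtain ⟨a₀, -, rfl⟩ := hC
  obtain ⟨b₀, hb₀, rfl⟩ := hD
  intro a' ha'
  obtain ⟨b', hb', hreach⟩ :=
    exists_asReach_lift hB hid hR hproj hab (Relation.ReflTransGen.trans ha.2 ha'.1)
  have h : asReach (QuotSubClass K) B b₀ b' := Relation.ReflTransGen.trans hb.1 hreach
  exact ⟨b', ⟨h, hb₀ _ h⟩, hb'⟩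

end UAlgebra

/-- for a subdirect product `R` of two smooth finite idempotent
algebras omitting type 1 and as-components `C1`, `C2`, the intersection
`R ∩ (C1 × C2)` is empty or a subdirect product of `C1 × C2`. -/
theorem stmt_8 (σ : Signature) (A1 A2 : UAlgebra σ)
    (hfin1 : Finite A1.carrier) (hfin2 : Finite A2.carrier)
    (hne1 : Nonempty A1.carrier) (hne2 : Nonempty A2.carrier)
    (hid1 : A1.Idempotent) (hid2 : A2.Idempotent)
    (hsm1 : A1.IsSmooth) (hsm2 : A2.IsSmooth)
    (h11 : A1.OmitsType1) (h12 : A2.OmitsType1)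
    (R : Set (A1.prod A2).carrier) (hRcl : (A1.prod A2).IsClosed R)
    (hRne : R.Nonempty)
    (hsub1 : ∀ a : A1.carrier, ∃ p ∈ R, p.1 = a)
    (hsub2 : ∀ b : A2.carrier, ∃ p ∈ R, p.2 = b)
    (C1 : Set A1.carrier) (hC1 : IsAsComponent (QuotSubClass {A1, A2}) A1 C1)
    (C2 : Set A2.carrier) (hC2 : IsAsComponent (QuotSubClass {A1, A2}) A2 C2) :
    R ∩ (C1 ×ˢ C2) = ∅ ∨
    ((∀ a ∈ C1, ∃ b ∈ C2, (a, b) ∈ R) ∧ (∀ b ∈ C2, ∃ a ∈ C1, (a, b) ∈ R)) := by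
  rw [or_iff_not_imp_left, ← ne_eq, ← Set.nonempty_iff_ne_empty]
  rintro ⟨⟨a, b⟩, hab, ha, hb⟩
  refine ⟨UAlgebra.exists_mem_asComponent (Or.inr rfl) hid2 hRcl hsub1 hC1 hC2 hab ha hb, ?_⟩
  have hswap : (A2.prod A1).IsClosed {p | (p.2, p.1) ∈ R} :=
    fun f x hx => hRcl f (fun j => ((x j).2, (x j).1)) hx
  refine UAlgebra.exists_mem_asComponent (Or.inl rfl) hid1 hswap ?_ hC2 hC1 hab hb ha
  intro b'
  obtain ⟨p, hp, rfl⟩ := hsub2 b'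
  exact ⟨(p.2, p.1), hp, rfl⟩
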